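/- arXiv:2410.02268 — 3 statements merged into one kernel-verified Lean document; each statement's English description precedes it below -/
import Mathlib

section
/- Let G = (V, E, W) be a finite undirected weighted graph and T an encoding tree for G. Then the structural entropy satisfies H(G,T) = (1/vol(V)) · ( 2·∑_{{x,y}∈E} W(x,y)·log vol(α_{x∨y}) − ∑_{x∈V} d(x)·log d(x) ), where α_{x∨y} is the least common ancestor in T of the leaves corresponding to x and y. -/
open scoped Classical
open Finset

/-- An encoding tree for a graph on vertex set `V`: a finite rooted tree (given by a
parent function under which every node reaches the root) together with a bijection
between its leaves and the elements of `V`, and the least-common-ancestor operation. -/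
structure EncodingTree (V : Type) [Fintype V] where
  /-- the type of tree nodes -/
  N : Type
  fintypeN : Fintype N
  root : N
  parent : N → N
  parent_root : parent root = root
  reaches_root : ∀ α : N, ∃ m : ℕ, parent^[m] α = root
  /-- the leaf corresponding to a graph node -/
  leafOf : V → N
  leafOf_inj : Function.Injective leafOf
  /-- the leaves (nodes without children) are exactly the images of graph nodes -/
  leaf_iff : ∀ α : N, (¬ ∃ β : N, β ≠ root ∧ parent β = α) ↔ α ∈ Set.range leafOf
  /-- least common ancestor -/
  lca : N → N → N
  lca_anc_left : ∀ α β : N, ∃ m : ℕ, parent^[m] α = lca α β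
  lca_anc_right : ∀ α β : N, ∃ m : ℕ, parent^[m] β = lca α β
  lca_min : ∀ α β γ : N, (∃ m : ℕ, parent^[m] α = γ) → (∃ m : ℕ, parent^[m] β = γ) →
      ∃ m : ℕ, parent^[m] (lca α β) = γ

attribute [instance] EncodingTree.fintypeN

variable {V : Type} [Fintype V]

/-- weighted degree `d(x) = ∑_{y} W(x,y)` -/
noncomputable def deg (W : V → V → ℝ) (x : V) : ℝ := ∑ y, W x y

/-- total volume `vol(V) = ∑_{x ∈ V} d(x)` -/
noncomputable def volV (W : V → V → ℝ) : ℝ := ∑ x, deg W x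

namespace EncodingTree

variable (T : EncodingTree V)

/-- the community of a tree node: graph nodes whose leaves are descendants of it -/
noncomputable def community (α : T.N) : Finset V :=
  Finset.univ.filter (fun x => ∃ m : ℕ, T.parent^[m] (T.leafOf x) = α)

/-- `vol(α) = ∑_{x ∈ C(α)} d(x)` -/
noncomputable def vol (W : V → V → ℝ) (α : T.N) : ℝ :=
  ∑ x ∈ T.community α, deg W x

/-- `g(α) = ∑_{x ∈ C(α)} ∑_{y ∉ C(α)} W(x,y)` -/
noncomputable def g (W : V → V → ℝ) (α : T.N) : ℝ :=
  ∑ x ∈ T.community α, ∑ y ∈ (T.community α)ᶜ, W x y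

/-- structural entropy `H(G,T)` -/
noncomputable def H (W : V → V → ℝ) : ℝ :=
  -∑ α ∈ Finset.univ.filter (fun α : T.N => α ≠ T.root),
      (T.g W α / volV W) * Real.log (T.vol W α / T.vol W (T.parent α))

end EncodingTree

namespace EncodingTree

theorem mem_community (T : EncodingTree V) (α : T.N) (x : V) :
    x ∈ T.community α ↔ ∃ m : ℕ, T.parent^[m] (T.leafOf x) = α := by
  simp [community]

theorem iterate_parent_root (T : EncodingTree V) (m : ℕ) : T.parent^[m] T.root = T.root :=
  Function.iterate_fixed T.parent_root m

/-- The only node on a cycle of the parent function is the root. -/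
theorem eq_root_of_iterate_parent_eq_self (T : EncodingTree V) {α : T.N} {n : ℕ} (hn : 0 < n)
    (h : T.parent^[n] α = α) : α = T.root := by
  obtain ⟨m, hm⟩ := T.reaches_root α
  have hcycle : T.parent^[n * m] α = α := by
    rw [Function.iterate_mul]
    exact Function.iterate_fixed h m
  have hle : m ≤ n * m := Nat.le_mul_of_pos_left m hn
  rw [← hcycle, ← Nat.sub_add_cancel hle, Function.iterate_add_apply, hm, iterate_parent_root]

theorem eq_root_of_iterate_parent_eq (T : EncodingTree V) {α : T.N} {i j : ℕ} (hij : i < j)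
    (h : T.parent^[i] α = T.parent^[j] α) : T.parent^[i] α = T.root := by
  refine T.eq_root_of_iterate_parent_eq_self (Nat.sub_pos_of_lt hij) ?_
  rw [← Function.iterate_add_apply, Nat.sub_add_cancel hij.le, h]

theorem community_leafOf (T : EncodingTree V) (x : V) : T.community (T.leafOf x) = {x} := by
  ext y
  rw [mem_community, Finset.mem_singleton]
  refine ⟨fun ⟨m, hm⟩ => ?_, fun h => ⟨0, by rw [h]; rfl⟩⟩
  induction m with
  | zero => exact T.leafOf_inj hm
  | succ m ih =>
    apply ih
    rw [Function.iterate_succ_apply'] at hm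
    by_cases hroot : T.parent^[m] (T.leafOf y) = T.root
    · rw [hroot, T.parent_root] at hm
      rw [hroot, hm]
    · exact absurd ⟨_, hroot, hm⟩ ((T.leaf_iff (T.leafOf x)).2 ⟨x, rfl⟩)

theorem vol_leafOf (T : EncodingTree V) (W : V → V → ℝ) (x : V) :
    T.vol W (T.leafOf x) = deg W x := by
  simp [vol, community_leafOf]

theorem vol_pos (T : EncodingTree V) {W : V → V → ℝ} (hdeg : ∀ x, 0 < deg W x) {α : T.N} {x : V}
    (hx : x ∈ T.community α) : 0 < T.vol W α :=
  Finset.sum_pos (fun y _ => hdeg y) ⟨x, hx⟩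

theorem mem_community_parent (T : EncodingTree V) {α : T.N} {x : V} (hx : x ∈ T.community α) :
    x ∈ T.community (T.parent α) := by
  rw [mem_community] at hx ⊢
  obtain ⟨m, hm⟩ := hx
  exact ⟨m + 1, by rw [Function.iterate_succ_apply', hm]⟩

/-- The nodes whose community separates `x` from `y` form the path from the leaf of `x` up to,
but excluding, the least common ancestor, so a sum of differences along parents telescopes. -/
theorem sum_separating_sub_parent (T : EncodingTree V) (L : T.N → ℝ) (x y : V) :
    ∑ α ∈ Finset.univ.filter
        (fun α : T.N => α ≠ T.root ∧ x ∈ T.community α ∧ y ∉ T.community α),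
      (L α - L (T.parent α)) = L (T.leafOf x) - L (T.lca (T.leafOf x) (T.leafOf y)) := by
  have hex := T.lca_anc_left (T.leafOf x) (T.leafOf y)
  obtain ⟨n, hn⟩ := T.lca_anc_right (T.leafOf x) (T.leafOf y)
  set k := Nat.find hex with hk
  have hspec : T.parent^[k] (T.leafOf x) = T.lca (T.leafOf x) (T.leafOf y) := Nat.find_spec hex
  have hne_root : ∀ i < k, T.parent^[i] (T.leafOf x) ≠ T.root := by
    intro i hi hroot
    refine Nat.find_min hex hi ?_
    rw [← hspec, ← Nat.sub_add_cancel hi.le, Function.iterate_add_apply, hroot,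
      iterate_parent_root]
  have hset : Finset.univ.filter
      (fun α : T.N => α ≠ T.root ∧ x ∈ T.community α ∧ y ∉ T.community α) =
      (Finset.range k).image (fun i => T.parent^[i] (T.leafOf x)) := by
    ext α
    simp only [Finset.mem_filter, Finset.mem_univ, true_and, Finset.mem_image, Finset.mem_range,
      mem_community]
    constructor
    · rintro ⟨-, ⟨m, rfl⟩, hy⟩
      refine ⟨m, not_le.1 fun hkm => hy ⟨m - k + n, ?_⟩, rfl⟩
      rw [Function.iterate_add_apply, hn, ← hspec, ← Function.iterate_add_apply,
        Nat.sub_add_cancel hkm]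
    · rintro ⟨i, hi, rfl⟩
      refine ⟨hne_root i hi, ⟨i, rfl⟩, fun hy => ?_⟩
      obtain ⟨m, hm⟩ := T.lca_min _ _ _ ⟨i, rfl⟩ hy
      rw [← hspec, ← Function.iterate_add_apply] at hm
      exact hne_root i hi (T.eq_root_of_iterate_parent_eq (by omega) hm.symm)
  have hinj : Set.InjOn (fun i => T.parent^[i] (T.leafOf x)) (Finset.range k) := by
    intro i hi j hj hij
    rw [Finset.mem_coe, Finset.mem_range] at hi hj
    rcases lt_trichotomy i j with h | h | h
    · exact absurd (T.eq_root_of_iterate_parent_eq h hij) (hne_root i hi)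
    · exact h
    · exact absurd (T.eq_root_of_iterate_parent_eq h hij.symm) (hne_root j hj)
  rw [hset, Finset.sum_image hinj, ← hspec]
  simp only [← Function.iterate_succ_apply' T.parent]
  exact Finset.sum_range_sub' (fun i => L (T.parent^[i] (T.leafOf x))) k

theorem g_mul_log_vol_div (T : EncodingTree V) {W : V → V → ℝ} (hdeg : ∀ x, 0 < deg W x)
    (α : T.N) :
    T.g W α * Real.log (T.vol W α / T.vol W (T.parent α)) =
      ∑ x, ∑ y, if x ∈ T.community α ∧ y ∉ T.community α then
        W x y * (Real.log (T.vol W α) - Real.log (T.vol W (T.parent α))) else 0 := by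
  have hg : T.g W α =
      ∑ x, ∑ y, if x ∈ T.community α ∧ y ∉ T.community α then W x y else 0 := by
    simp only [g, ite_and, Finset.sum_ite_irrel, Finset.sum_const_zero, ← Finset.sum_filter,
      ← Finset.mem_compl, Finset.filter_univ_mem]
  rw [hg, Finset.sum_mul]
  refine Finset.sum_congr rfl fun x _ => ?_
  rw [Finset.sum_mul]
  refine Finset.sum_congr rfl fun y _ => ?_
  split_ifs with h
  · rw [Real.log_div (T.vol_pos hdeg h.1).ne'
      (T.vol_pos hdeg (T.mem_community_parent h.1)).ne']
  · exact zero_mul _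

/-- The structural entropy as a sum over ordered pairs of graph nodes. -/
theorem H_eq_sum_sum (T : EncodingTree V) {W : V → V → ℝ} (hdeg : ∀ x, 0 < deg W x) :
    T.H W = (1 / volV W) * ∑ x, ∑ y, W x y *
      (Real.log (T.vol W (T.lca (T.leafOf x) (T.leafOf y))) - Real.log (deg W x)) := by
  have hswap : ∑ α ∈ Finset.univ.filter (fun α : T.N => α ≠ T.root),
      T.g W α * Real.log (T.vol W α / T.vol W (T.parent α)) =
      ∑ x, ∑ y, W x y *
        (Real.log (deg W x) - Real.log (T.vol W (T.lca (T.leafOf x) (T.leafOf y)))) := by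
    simp only [T.g_mul_log_vol_div hdeg]
    rw [Finset.sum_comm]
    refine Finset.sum_congr rfl fun x _ => ?_
    rw [Finset.sum_comm]
    refine Finset.sum_congr rfl fun y _ => ?_
    rw [← Finset.sum_filter, Finset.filter_filter, ← Finset.mul_sum,
      T.sum_separating_sub_parent (fun α => Real.log (T.vol W α)), vol_leafOf]
  have hneg : ∑ x, ∑ y, W x y *
      (Real.log (T.vol W (T.lca (T.leafOf x) (T.leafOf y))) - Real.log (deg W x)) =
      -∑ x, ∑ y, W x y *
        (Real.log (deg W x) - Real.log (T.vol W (T.lca (T.leafOf x) (T.leafOf y)))) := by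
    simp only [← Finset.sum_neg_distrib, ← mul_neg, neg_sub]
  rw [hneg, ← hswap, H, mul_neg, Finset.mul_sum]
  congr 1
  refine Finset.sum_congr rfl fun α _ => ?_
  ring

end EncodingTree

/-- A function on unordered pairs vanishing on the diagonal, summed over ordered pairs. -/
theorem sum_sum_sym2_mk (f : Sym2 V → ℝ) (hf : ∀ x, f s(x, x) = 0) :
    ∑ x, ∑ y, f s(x, y) = 2 * ∑ e, f e := by
  rw [← Fintype.sum_prod_type' (fun x y => f s(x, y)),
    ← Finset.sum_fiberwise Finset.univ (fun p : V × V => s(p.1, p.2)), Finset.mul_sum]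
  refine Finset.sum_congr rfl fun e _ => ?_
  induction e using Sym2.ind with
  | _ x y =>
    by_cases hxy : x = y
    · subst hxy
      rw [hf, mul_zero]
      refine Finset.sum_eq_zero fun p hp => ?_
      rw [(Finset.mem_filter.1 hp).2, hf]
    · have hfiber : Finset.univ.filter (fun p : V × V => s(p.1, p.2) = s(x, y)) =
          {(x, y), (y, x)} := by
        ext ⟨a, b⟩
        simp
      have hne : (x, y) ≠ (y, x) := fun h => hxy (Prod.ext_iff.1 h).1
      rw [hfiber, Finset.sum_pair hne, Sym2.eq_swap (a := y), two_mul]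

/-- **Lemma 1.** For a finite undirected weighted graph `G = (V, E, W)` and an encoding
tree `T`, the structural entropy satisfies
`H(G,T) = (1/vol(V)) · (2·∑_{{x,y}∈E} W(x,y)·log vol(α_{x∨y}) − ∑_{x∈V} d(x)·log d(x))`,
where the edge sum is over unordered pairs (the symmetric functions `Wf` and `f` on
unordered pairs are the descents of `W(x,y)` and of `W(x,y)·log vol(α_{x∨y})`). -/
theorem structural_entropy_edge_formula
    [Nonempty V] (W : V → V → ℝ) (T : EncodingTree V)
    (hsymm : ∀ x y, W x y = W y x)
    (hdiag : ∀ x, W x x = 0)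
    (hnonneg : ∀ x y, 0 ≤ W x y)
    (hdeg : ∀ x, 0 < deg W x)
    (Wf : Sym2 V → ℝ) (hWf : ∀ x y, Wf s(x, y) = W x y)
    (f : Sym2 V → ℝ)
    (hf : ∀ x y, f s(x, y) = W x y * Real.log (T.vol W (T.lca (T.leafOf x) (T.leafOf y)))) :
    T.H W = (1 / volV W) *
      (2 * ∑ e ∈ Finset.univ.sym2.filter (fun e => 0 < Wf e), f e
        - ∑ x, deg W x * Real.log (deg W x)) := by
  have hedges : ∑ e ∈ Finset.univ.sym2.filter (fun e => 0 < Wf e), f e = ∑ e, f e := by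
    rw [Finset.sym2_univ]
    refine Finset.sum_filter_of_ne fun e _ => ?_
    induction e using Sym2.ind with
    | _ x y =>
      rw [hf, hWf]
      exact fun h => (hnonneg x y).lt_of_ne' (left_ne_zero_of_mul h)
  rw [T.H_eq_sum_sum hdeg, hedges,
    ← sum_sum_sym2_mk f (fun x => by rw [hf, hdiag, zero_mul])]
  simp only [hf, mul_sub, Finset.sum_sub_distrib, ← Finset.sum_mul]
  rfl
end

section
/- (Proposition 1) Let G = (V, E, W) be a finite undirected weighted graph and T an encoding tree for G, and let φ(u) be the Shapley value of node u for the subgraph value function F. Then φ(u) = (1/vol(V)) · ( ∑_{{u,v}∈E} W(u,v)·log vol(α_{u∨v}) − d(u)·log d(u) ). -/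
open scoped Classical
open Finset

variable {V : Type} [Fintype V]

/-- The reciprocal binomial weights of the Shapley value sum to `#A + 1`. -/
lemma sum_powerset_inv_choose {α : Type*} (A : Finset α) :
    ∑ S ∈ A.powerset, ((Nat.choose A.card S.card : ℝ))⁻¹ = A.card + 1 := by
  rw [Finset.sum_powerset_apply_card (fun m => ((Nat.choose A.card m : ℝ))⁻¹)]
  have h : ∀ m ∈ Finset.range (A.card + 1),
      A.card.choose m • ((Nat.choose A.card m : ℝ))⁻¹ = 1 := by
    intro m hm
    have hpos := Nat.choose_pos (Nat.lt_succ_iff.mp (Finset.mem_range.mp hm))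
    rw [nsmul_eq_mul, mul_inv_cancel₀ (by positivity)]
  rw [Finset.sum_congr rfl h]
  simp

/-- Under the Shapley weights, every element of `A` counts one half on average. -/
lemma sum_powerset_inv_choose_mul {α : Type*} (A : Finset α) (g : α → ℝ) (D : ℝ) :
    ∑ S ∈ A.powerset, ((Nat.choose A.card S.card : ℝ))⁻¹ * (2 * ∑ v ∈ S, g v - D)
      = (A.card + 1) * (∑ v ∈ A, g v - D) := by
  have hrefl : ∑ S ∈ A.powerset, ((Nat.choose A.card S.card : ℝ))⁻¹ * (2 * ∑ v ∈ S, g v - D)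
      = ∑ S ∈ A.powerset,
        ((Nat.choose A.card S.card : ℝ))⁻¹ * (2 * ∑ v ∈ A \ S, g v - D) := by
    refine Finset.sum_nbij' (fun S => A \ S) (fun S => A \ S) ?_ ?_ ?_ ?_ ?_
    · intro S _; simp
    · intro S _; simp
    · intro S hS; simpa using Finset.mem_powerset.mp hS
    · intro S hS; simpa using Finset.mem_powerset.mp hS
    · intro S hS
      have hSA := Finset.mem_powerset.mp hS
      rw [Finset.card_sdiff_of_subset hSA, Nat.choose_symm (Finset.card_le_card hSA),
        Finset.sdiff_sdiff_eq_self hSA]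
  have hadd : ∑ S ∈ A.powerset, ((Nat.choose A.card S.card : ℝ))⁻¹ * (2 * ∑ v ∈ S, g v - D)
      + ∑ S ∈ A.powerset, ((Nat.choose A.card S.card : ℝ))⁻¹ * (2 * ∑ v ∈ A \ S, g v - D)
      = (∑ S ∈ A.powerset, ((Nat.choose A.card S.card : ℝ))⁻¹)
        * (2 * (∑ v ∈ A, g v - D)) := by
    rw [← Finset.sum_add_distrib, Finset.sum_mul]
    refine Finset.sum_congr rfl fun S hS => ?_
    rw [← Finset.sum_sdiff (Finset.mem_powerset.mp hS)]
    ring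
  rw [← hrefl, sum_powerset_inv_choose] at hadd
  linarith

/-- Adding a new element `u` to `S` adds the pairs `s(u, b)` to `S.sym2`. -/
lemma sum_sym2_insert {α : Type*} (f : Sym2 α → ℝ) {S : Finset α} {u : α}
    (hu : u ∉ S) :
    ∑ e ∈ (insert u S).sym2, f e
      = f s(u, u) + ∑ v ∈ S, f s(u, v) + ∑ e ∈ S.sym2, f e := by
  rw [Finset.sym2_insert, Finset.sum_union, Finset.sum_image, Finset.sum_insert hu]
  · intro a _ b _ h
    exact Sym2.congr_right.mp h
  · rw [Finset.disjoint_left]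
    intro e he hS
    obtain ⟨b, _, rfl⟩ := Finset.mem_image.mp he
    exact hu (Finset.mk_mem_sym2_iff.mp hS).1

/-- **Proposition 1.** The Shapley value of a node `u` for the subgraph value function
`F(S) = (1/vol(V)) · (2·∑_{{x,y}∈E, x∈S, y∈S} W(x,y)·log vol(α_{x∨y}) − ∑_{x∈S} d(x)·log d(x))`
equals `(1/vol(V)) · (∑_{{u,v}∈E} W(u,v)·log vol(α_{u∨v}) − d(u)·log d(u))`.
Here `Wf` and `f` are the descents to unordered pairs of `W(x,y)` and of
`W(x,y)·log vol(α_{x∨y})`, and the Shapley value is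
`φ(u) = (1/|V|) · ∑_{S ⊆ V∖{u}} binom(|V|−1,|S|)⁻¹ · (F(S∪{u}) − F(S))`. -/
theorem shapley_value_structural_entropy
    [Nonempty V] (W : V → V → ℝ) (T : EncodingTree V)
    (hsymm : ∀ x y, W x y = W y x)
    (hdiag : ∀ x, W x x = 0)
    (hnonneg : ∀ x y, 0 ≤ W x y)
    (hdeg : ∀ x, 0 < deg W x)
    (Wf : Sym2 V → ℝ) (hWf : ∀ x y, Wf s(x, y) = W x y)
    (f : Sym2 V → ℝ)
    (hf : ∀ x y, f s(x, y) = W x y * Real.log (T.vol W (T.lca (T.leafOf x) (T.leafOf y))))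
    (F : Finset V → ℝ)
    (hF : ∀ S : Finset V, F S = (1 / volV W) *
      (2 * ∑ e ∈ S.sym2.filter (fun e => 0 < Wf e), f e
        - ∑ x ∈ S, deg W x * Real.log (deg W x)))
    (u : V) :
    (1 / (Fintype.card V : ℝ)) *
      ∑ S ∈ (Finset.univ.erase u).powerset,
        ((Nat.choose (Fintype.card V - 1) S.card : ℝ))⁻¹ * (F (insert u S) - F S)
    = (1 / volV W) *
      ((∑ v ∈ Finset.univ.filter (fun v => 0 < W u v),
          W u v * Real.log (T.vol W (T.lca (T.leafOf u) (T.leafOf v))))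
        - deg W u * Real.log (deg W u)) := by
  set g : V → ℝ := fun v =>
    W u v * Real.log (T.vol W (T.lca (T.leafOf u) (T.leafOf v))) with hg
  have hpairs : ∀ S : Finset V,
      ∑ e ∈ S.sym2.filter (fun e => 0 < Wf e), f e = ∑ e ∈ S.sym2, f e := by
    intro S
    refine Finset.sum_filter_of_ne fun e _ => ?_
    induction e using Sym2.ind with
    | _ x y =>
      intro hne
      rw [hWf]
      refine (hnonneg x y).lt_of_ne' fun h0 => hne ?_
      rw [hf, h0, zero_mul]
  have hguu : g u = 0 := by simp [hg, hdiag]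
  have hmarginal : ∀ S ∈ (Finset.univ.erase u).powerset, F (insert u S) - F S
      = (1 / volV W) * (2 * ∑ v ∈ S, g v - deg W u * Real.log (deg W u)) := by
    intro S hS
    have hu : u ∉ S := fun h => by simpa using Finset.mem_powerset.mp hS h
    rw [hF, hF, hpairs, hpairs, sum_sym2_insert f hu, Finset.sum_insert hu,
      show f s(u, u) = 0 from (hf u u).trans hguu,
      Finset.sum_congr rfl fun v _ => hf u v]
    ring
  have hcard : (Finset.univ.erase u).card = Fintype.card V - 1 := by
    rw [Finset.card_erase_of_mem (Finset.mem_univ u), Finset.card_univ]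
  have hcard' : ((Finset.univ.erase u).card : ℝ) + 1 = Fintype.card V := by
    exact_mod_cast Finset.card_erase_add_one (Finset.mem_univ u)
  have hn : (Fintype.card V : ℝ) ≠ 0 := by exact_mod_cast Fintype.card_ne_zero
  have hneighbors : ∑ v ∈ Finset.univ.filter (fun v => 0 < W u v), g v
      = ∑ v ∈ Finset.univ.erase u, g v := by
    rw [Finset.sum_erase _ hguu]
    refine Finset.sum_filter_of_ne fun v _ hne => ?_
    refine (hnonneg u v).lt_of_ne' fun h0 => hne ?_
    simp [hg, h0]
  rw [hneighbors, Finset.sum_congr rfl fun S hS => by rw [hmarginal S hS, mul_left_comm],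
    ← Finset.mul_sum, ← hcard, sum_powerset_inv_choose_mul, hcard']
  field_simp
end

section
/- (Explicit bound on node-level structural entropy, from the proof of Theorem 1) Let k ≥ 1, R > 0, and let w_1, …, w_k ∈ (0, R], vol_1, …, vol_k > 0, and n_1, …, n_k > 0 be real numbers such that vol_i ≤ k·R·n_i for every i. Define S_e = min over all permutations π of {1, …, k} of ∑_{i=1}^k w_{π(i)} · log( ∑_{j=1}^i vol_{π(j)} ). If k²·R·( ∑_{i=1}^k n_i w_i ) / ( ∑_{i=1}^k w_i ) ≥ 1, then S_e ≤ k·R · log( k²·R·( ∑_{i=1}^k n_i w_i ) / ( ∑_{i=1}^k w_i ) ). -/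
open Finset

/-- Weighted Jensen inequality for the logarithm with unnormalised positive weights. -/
theorem sum_mul_log_le_log_weighted_mean {ι : Type*} (s : Finset ι) (w a : ι → ℝ)
    (hw : ∀ i ∈ s, 0 < w i) (ha : ∀ i ∈ s, 0 < a i) :
    ∑ i ∈ s, w i * Real.log (a i)
      ≤ (∑ i ∈ s, w i) * Real.log ((∑ i ∈ s, w i * a i) / ∑ i ∈ s, w i) := by
  rcases s.eq_empty_or_nonempty with rfl | hs
  · simp
  have hW : 0 < ∑ i ∈ s, w i := Finset.sum_pos hw hs
  have hS : 0 < ∑ i ∈ s, w i * a i := Finset.sum_pos (fun i hi => mul_pos (hw i hi) (ha i hi)) hs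
  set A := (∑ i ∈ s, w i * a i) / ∑ i ∈ s, w i with hA
  have hApos : 0 < A := div_pos hS hW
  calc ∑ i ∈ s, w i * Real.log (a i)
      ≤ ∑ i ∈ s, (w i * Real.log A + (w i * a i) / A - w i) := by
        refine Finset.sum_le_sum fun i hi => ?_
        have h := Real.log_le_sub_one_of_pos (div_pos (ha i hi) hApos)
        rw [Real.log_div (ha i hi).ne' hApos.ne'] at h
        have h' := mul_le_mul_of_nonneg_left h (hw i hi).le
        rw [mul_div_assoc]
        linarith
    _ = (∑ i ∈ s, w i) * Real.log A := by
        rw [Finset.sum_sub_distrib, Finset.sum_add_distrib, ← Finset.sum_mul, ← Finset.sum_div]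
        have : (∑ i ∈ s, w i * a i) / A = ∑ i ∈ s, w i := by
          rw [hA]
          field_simp
        rw [this]
        ring

/-- A prefix sum of a monotone nonnegative sequence of length `k` is at most `k` times its last
term. -/
theorem sum_Iic_le_mul_of_monotone {k : ℕ} {f : Fin k → ℝ} (hf : Monotone f)
    (i : Fin k) (hi : 0 ≤ f i) : ∑ j ∈ Finset.Iic i, f j ≤ (k : ℝ) * f i := by
  have h := Finset.sum_le_card_nsmul (Finset.Iic i) f (f i) fun j hj => hf (Finset.mem_Iic.1 hj)
  rw [nsmul_eq_mul] at h
  refine h.trans (mul_le_mul_of_nonneg_right ?_ hi)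
  exact_mod_cast (Finset.card_le_univ _).trans_eq (Fintype.card_fin k)

/-- **Explicit bound on node-level structural entropy** (from the proof of Theorem 1).
Let `k ≥ 1`, `R > 0`, weights `w_i ∈ (0, R]`, volumes `vol_i > 0` and `n_i > 0` with
`vol_i ≤ k·R·n_i` for every `i`. Define `S_e` as the minimum over all permutations `π`
of `{1,…,k}` of `∑_{i=1}^k w_{π(i)} · log(∑_{j=1}^i vol_{π(j)})`. If
`k²·R·(∑_i n_i w_i)/(∑_i w_i) ≥ 1`, then
`S_e ≤ k·R·log( k²·R·(∑_i n_i w_i)/(∑_i w_i) )`. -/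
theorem node_level_structural_entropy_bound
    (k : ℕ) (hk : 1 ≤ k) (R : ℝ) (hR : 0 < R)
    (w vol n : Fin k → ℝ)
    (hw : ∀ i, 0 < w i ∧ w i ≤ R)
    (hvol : ∀ i, 0 < vol i)
    (hn : ∀ i, 0 < n i)
    (hbound : ∀ i, vol i ≤ (k : ℝ) * R * n i)
    (hcond : 1 ≤ (k : ℝ) ^ 2 * R * (∑ i, n i * w i) / (∑ i, w i)) :
    (Finset.univ.inf' ⟨1, Finset.mem_univ 1⟩
        (fun π : Equiv.Perm (Fin k) =>
          ∑ i, w (π i) * Real.log (∑ j ∈ Finset.Iic i, vol (π j))))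
      ≤ (k : ℝ) * R * Real.log ((k : ℝ) ^ 2 * R * (∑ i, n i * w i) / (∑ i, w i)) := by
  have hk0 : (0 : ℝ) < k := by exact_mod_cast hk
  let π : Equiv.Perm (Fin k) := Tuple.sort vol
  have hmono : Monotone fun i => vol (π i) := Tuple.monotone_sort vol
  have hprefix (i : Fin k) :
      ∑ j ∈ Finset.Iic i, vol (π j) ≤ (k : ℝ) ^ 2 * R * n (π i) := by
    have h₁ := sum_Iic_le_mul_of_monotone hmono i (hvol (π i)).le
    have h₂ := mul_le_mul_of_nonneg_left (hbound (π i)) hk0.le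
    calc _ ≤ _ := h₁.trans h₂
      _ = _ := by ring
  have hmean : (∑ i, w i * ((k : ℝ) ^ 2 * R * n i)) / ∑ i, w i
      = (k : ℝ) ^ 2 * R * (∑ i, n i * w i) / ∑ i, w i := by
    rw [Finset.mul_sum]
    congr 1
    exact Finset.sum_congr rfl fun i _ => by ring
  have hW : ∑ i, w i ≤ (k : ℝ) * R := by
    simpa using Finset.sum_le_card_nsmul Finset.univ w R fun i _ => (hw i).2
  calc _ ≤ ∑ i, w (π i) * Real.log (∑ j ∈ Finset.Iic i, vol (π j)) :=
        Finset.inf'_le _ (Finset.mem_univ π)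
    _ ≤ ∑ i, w (π i) * Real.log ((k : ℝ) ^ 2 * R * n (π i)) := by
        refine Finset.sum_le_sum fun i _ =>
          mul_le_mul_of_nonneg_left (Real.log_le_log ?_ (hprefix i)) (hw (π i)).1.le
        exact Finset.sum_pos (fun j _ => hvol (π j)) ⟨i, Finset.mem_Iic.2 le_rfl⟩
    _ = ∑ i, w i * Real.log ((k : ℝ) ^ 2 * R * n i) :=
        Equiv.sum_comp π fun i => w i * Real.log ((k : ℝ) ^ 2 * R * n i)
    _ ≤ (∑ i, w i) * Real.log ((∑ i, w i * ((k : ℝ) ^ 2 * R * n i)) / ∑ i, w i) :=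
        sum_mul_log_le_log_weighted_mean _ _ _ (fun i _ => (hw i).1) fun i _ =>
          mul_pos (by positivity) (hn i)
    _ ≤ _ := by
        rw [hmean]
        exact mul_le_mul_of_nonneg_right hW (Real.log_nonneg hcond)
end
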